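/- Let t ≥ 3 and let U_1, …, U_t be subspaces of V, and let δ denote the common value dim A_k − dim C_k. Then there exist subspaces W_1, …, W_t, each an admissible complement at the corresponding index and each of dimension δ, together with for each k a basis (w_k^1, …, w_k^δ) of W_k, such that w_1^i + w_2^i + ⋯ + w_t^i = 0 for every i ∈ {1,…,δ}; moreover, for every subset S ⊆ {1,…,t} with |S| = t − 1 the family (W_k)_{k ∈ S} is independent. -/

import Mathlib

open Module

/-- `A_k := U_k ⊓ (⊔_{j ≠ k} U_j)`. -/
def subA {F V : Type*} [Field F] [AddCommGroup V] [Module F V] {t : ℕ}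
    (U : Fin t → Submodule F V) (k : Fin t) : Submodule F V :=
  U k ⊓ (⨆ j : Fin t, ⨆ _ : j ≠ k, U j)

/-- `C_k := ⊔_{ℓ ≠ k} ( U_k ⊓ (⊔_{j ∉ {k,ℓ}} U_j) )`. -/
def subC {F V : Type*} [Field F] [AddCommGroup V] [Module F V] {t : ℕ}
    (U : Fin t → Submodule F V) (k : Fin t) : Submodule F V :=
  ⨆ l : Fin t, ⨆ _ : l ≠ k,
    (U k ⊓ (⨆ j : Fin t, ⨆ _ : j ≠ k ∧ j ≠ l, U j))

/-- `W` is an admissible complement at `k`: `W ≤ A_k`, `W ⊓ C_k = 0`, `W ⊔ C_k = A_k`. -/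
def IsAdmissibleComplement {F V : Type*} [Field F] [AddCommGroup V] [Module F V] {t : ℕ}
    (U : Fin t → Submodule F V) (k : Fin t) (W : Submodule F V) : Prop :=
  W ≤ subA U k ∧ W ⊓ subC U k = ⊥ ∧ W ⊔ subC U k = subA U k

section Helpers

variable {F V : Type*} [Field F] [AddCommGroup V] [Module F V] {t : ℕ}

/-- The relation space: tuples `u` with `u j ∈ U j` and `∑ u j = 0`. -/
def relK (U : Fin t → Submodule F V) : Submodule F (Fin t → V) where
  carrier := {u | (∀ j, u j ∈ U j) ∧ ∑ j, u j = 0}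
  add_mem' := by
    rintro a b ⟨ha, ha'⟩ ⟨hb, hb'⟩
    refine ⟨fun j => (U j).add_mem (ha j) (hb j), ?_⟩
    simp [Finset.sum_add_distrib, ha', hb']
  zero_mem' := by simp
  smul_mem' := by
    rintro c a ⟨ha, ha'⟩
    refine ⟨fun j => (U j).smul_mem c (ha j), ?_⟩
    simp [← Finset.smul_sum, ha']

/-- The span of the relations having at least one zero entry. -/
def relN (U : Fin t → Submodule F V) : Submodule F (Fin t → V) :=
  ⨆ l, relK U ⊓ LinearMap.ker (LinearMap.proj (R := F) (φ := fun _ : Fin t => V) l)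

theorem mem_relK {U : Fin t → Submodule F V} {u : Fin t → V} :
    u ∈ relK U ↔ (∀ j, u j ∈ U j) ∧ ∑ j, u j = 0 := Iff.rfl

theorem relN_le (U : Fin t → Submodule F V) : relN U ≤ relK U :=
  iSup_le fun _ => inf_le_left

theorem mem_relN {U : Fin t → Submodule F V} {u : Fin t → V} (l : Fin t)
    (hu : u ∈ relK U) (h : u l = 0) : u ∈ relN U :=
  Submodule.mem_iSup_of_mem l ⟨hu, by simpa using h⟩

theorem exists_tuple {U : Fin t → Submodule F V} {P : Fin t → Prop} {x : V}
    (hx : x ∈ ⨆ j : Fin t, ⨆ _ : P j, U j) :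
    ∃ u : Fin t → V, (∀ j, u j ∈ U j) ∧ (∀ j, ¬ P j → u j = 0) ∧ ∑ j, u j = x := by
  classical
  induction hx using Submodule.iSup_induction' with
  | mem i x hx =>
    by_cases hP : P i
    · simp only [hP, iSup_pos] at hx
      refine ⟨Pi.single i x, fun j => ?_, fun j hj => ?_, by simp⟩
      · by_cases h : j = i
        · subst h; simpa using hx
        · simp [h]
      · have : j ≠ i := by rintro rfl; exact hj hP
        simp [this]
    · simp only [hP, not_false_eq_true, iSup_neg, Submodule.mem_bot] at hx
      exact ⟨0, by simp, by simp, by simp [hx]⟩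
  | zero => exact ⟨0, by simp, by simp, by simp⟩
  | add x y _ _ hx hy =>
    obtain ⟨a, ha, ha', rfl⟩ := hx
    obtain ⟨b, hb, hb', rfl⟩ := hy
    exact ⟨a + b, fun j => (U j).add_mem (ha j) (hb j),
      fun j hj => by simp [ha' j hj, hb' j hj], by simp [Finset.sum_add_distrib]⟩

theorem exists_rel {U : Fin t → Submodule F V} {P : Fin t → Prop} {k : Fin t} {x : V}
    (hk : ¬ P k) (hx : x ∈ U k ⊓ ⨆ j : Fin t, ⨆ _ : P j, U j) :
    ∃ u ∈ relK U, u k = x ∧ ∀ j, j ≠ k → ¬ P j → u j = 0 := by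
  classical
  obtain ⟨hxk, hx⟩ := hx
  obtain ⟨u, hu, hu', hs⟩ := exists_tuple hx
  refine ⟨Pi.single k x - u, mem_relK.2 ⟨fun j => ?_, ?_⟩, ?_, fun j hj hP => ?_⟩
  · refine (U j).sub_mem ?_ (hu j)
    by_cases h : j = k
    · subst h; simpa using hxk
    · simp [h]
  · simp [Finset.sum_sub_distrib, hs]
  · simp [hu' k hk]
  · simp [hj, hu' j hP]

theorem rel_mem {U : Fin t → Submodule F V} {P : Fin t → Prop} {k : Fin t} {u : Fin t → V}
    (hu : u ∈ relK U) (h : ∀ j, j ≠ k → ¬ P j → u j = 0) :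
    u k ∈ U k ⊓ ⨆ j : Fin t, ⨆ _ : P j, U j := by
  classical
  obtain ⟨h1, h2⟩ := hu
  refine ⟨h1 k, ?_⟩
  rw [← Finset.add_sum_erase _ _ (Finset.mem_univ k)] at h2
  rw [eq_neg_of_add_eq_zero_left h2]
  refine Submodule.neg_mem _ (Submodule.sum_mem _ fun j hj => ?_)
  by_cases hP : P j
  · exact Submodule.mem_iSup_of_mem j (Submodule.mem_iSup_of_mem hP (h1 j))
  · rw [h j (Finset.ne_of_mem_erase hj) hP]; exact Submodule.zero_mem _

theorem map_relK (U : Fin t → Submodule F V) (k : Fin t) :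
    (relK U).map (LinearMap.proj k) = subA U k := by
  ext x
  constructor
  · rintro ⟨u, hu, rfl⟩
    exact rel_mem (P := fun j => j ≠ k) hu (fun j h h' => absurd h h')
  · intro hx
    obtain ⟨u, hu, h, -⟩ := exists_rel (P := fun j => j ≠ k) (by simp) hx
    exact ⟨u, hu, h⟩

theorem map_relN (U : Fin t → Submodule F V) (k : Fin t) :
    (relN U).map (LinearMap.proj k) = subC U k := by
  apply le_antisymm
  · rw [relN, Submodule.map_iSup]
    refine iSup_le fun l => ?_
    rintro _ ⟨u, ⟨hu, hl⟩, rfl⟩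
    have hl : u l = 0 := by simpa using hl
    by_cases h : l = k
    · subst h
      simp [hl]
    · refine Submodule.mem_iSup_of_mem l (Submodule.mem_iSup_of_mem h ?_)
      refine rel_mem (P := fun j => j ≠ k ∧ j ≠ l) hu (fun j h h' => ?_)
      have : j = l := by tauto
      rw [this, hl]
  · refine iSup_le fun l => iSup_le fun hl x hx => ?_
    obtain ⟨u, hu, h, h'⟩ := exists_rel (P := fun j => j ≠ k ∧ j ≠ l) (by simp) hx
    exact ⟨u, mem_relN l hu (h' l hl (by simp)), h⟩

/-- A relation whose `k`-th entry lies in `C_k` lies in `N`. -/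
theorem mem_relN_of_apply_mem {U : Fin t → Submodule F V} {k : Fin t} {u : Fin t → V}
    (hu : u ∈ relK U) (h : u k ∈ subC U k) : u ∈ relN U := by
  rw [← map_relN] at h
  obtain ⟨v, hv, hvu⟩ := h
  have hvu : v k = u k := hvu
  have h1 : u - v ∈ relN U :=
    mem_relN k ((relK U).sub_mem hu (relN_le U hv)) (by simp [hvu])
  simpa using (relN U).add_mem h1 hv

end Helpers

theorem stmt_5 (F V : Type*) [Field F] [AddCommGroup V] [Module F V]
    [FiniteDimensional F V] (t : ℕ) (ht : 3 ≤ t) (U : Fin t → Submodule F V)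
    (δ : ℕ)
    (hδ : ∀ k, (finrank F ↥(subA U k) : ℤ) - finrank F ↥(subC U k) = δ) :
    ∃ (W : Fin t → Submodule F V) (w : Fin t → Fin δ → V),
      (∀ k, IsAdmissibleComplement U k (W k)) ∧
      (∀ k, finrank F ↥(W k) = δ) ∧
      (∀ k i, w k i ∈ W k) ∧
      (∀ k, LinearIndependent F (w k)) ∧
      (∀ k, Submodule.span F (Set.range (w k)) = W k) ∧
      (∀ i, ∑ k, w k i = 0) ∧
      (∀ S : Finset (Fin t), S.card = t - 1 →
        finrank F ↥(⨆ k ∈ S, W k) = ∑ k ∈ S, finrank F ↥(W k)) := by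
  classical
  obtain ⟨Q, hQ⟩ := Submodule.exists_isCompl (relN U)
  set M := Q ⊓ relK U with hM
  have hMK : M ≤ relK U := inf_le_right
  have hdis : ∀ m ∈ M, m ∈ relN U → m = 0 := fun m hm hn =>
    (Submodule.mem_bot F).1 (hQ.inf_eq_bot ▸ ⟨hn, hm.1⟩)
  have hsup : M ⊔ relN U = relK U := by
    rw [hM, sup_comm, ← sup_inf_assoc_of_le _ (relN_le U), hQ.sup_eq_top, top_inf_eq]
  let p : Fin t → (Fin t → V) →ₗ[F] V := fun k => LinearMap.proj k
  have hinj : ∀ k, ∀ m ∈ M, m k ∈ subC U k → m = 0 := fun k m hm h =>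
    hdis m hm (mem_relN_of_apply_mem (hMK hm) h)
  have hinj' : ∀ k, Function.Injective ((p k).domRestrict M) := by
    intro k
    rw [← LinearMap.ker_eq_bot, LinearMap.ker_eq_bot']
    rintro ⟨m, hm⟩ h
    have h : m k = 0 := h
    exact Subtype.ext (hinj k m hm (by rw [h]; exact Submodule.zero_mem _))
  have hadm : ∀ k, IsAdmissibleComplement U k (M.map (p k)) := by
    intro k
    refine ⟨?_, ?_, ?_⟩
    · rw [← map_relK]; exact Submodule.map_mono hMK
    · rw [eq_bot_iff]
      rintro _ ⟨⟨m, hm, rfl⟩, h⟩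
      rw [hinj k m hm h]; simp
    · rw [← map_relK, ← map_relN, ← hsup, Submodule.map_sup]
  have hmapM : ∀ k, finrank F ↥(M.map (p k)) = finrank F M := by
    intro k
    rw [← LinearMap.finrank_range_of_inj (hinj' k), LinearMap.range_domRestrict]
  have hfr : ∀ k, finrank F ↥(M.map (p k)) = δ := by
    intro k
    obtain ⟨-, h2, h3⟩ := hadm k
    have := Submodule.finrank_sup_add_finrank_inf_eq (M.map (p k)) (subC U k)
    rw [h2, h3, finrank_bot] at this
    have := hδ k
    omega
  have hMδ : finrank F M = δ := by
    rw [← hmapM ⟨0, by omega⟩]; exact hfr _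
  let b := finBasisOfFinrankEq F M hMδ
  have hw : ∀ k, (fun i => (b i : Fin t → V) k) = (p k).domRestrict M ∘ b := fun k => rfl
  refine ⟨fun k => M.map (p k), fun k i => (b i : Fin t → V) k, hadm, hfr,
    fun k i => ⟨b i, (b i).2, rfl⟩, fun k => ?_, fun k => ?_, fun i => (hMK (b i).2).2, ?_⟩
  · beta_reduce
    rw [hw]
    exact b.linearIndependent.map' _ (LinearMap.ker_eq_bot.2 (hinj' k))
  · beta_reduce
    rw [hw, Set.range_comp, ← Submodule.map_span, b.span_eq, Submodule.map_top,
      LinearMap.range_domRestrict]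
  · intro S hS
    obtain ⟨q, hq⟩ : ∃ q, q ∉ S := by
      by_contra! h
      rw [Finset.eq_univ_iff_forall.2 h, Finset.card_univ, Fintype.card_fin] at hS
      omega
    let Φ : (S → M) →ₗ[F] V :=
      ∑ k : S, ((p k).domRestrict M) ∘ₗ (LinearMap.proj k : (S → M) →ₗ[F] M)
    have hΦ : ∀ f, Φ f = ∑ k : S, (f k : Fin t → V) k := by
      intro f
      simp only [Φ, LinearMap.sum_apply]
      rfl
    have hran : LinearMap.range Φ = ⨆ k ∈ S, M.map (p k) := by
      apply le_antisymm
      · rintro _ ⟨f, rfl⟩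
        rw [hΦ]
        exact Submodule.sum_mem _ fun k _ => Submodule.mem_iSup_of_mem k.1
          (Submodule.mem_iSup_of_mem k.2 ⟨f k, (f k).2, rfl⟩)
      · refine iSup_le fun k => iSup_le fun hk => ?_
        rintro _ ⟨m, hm, rfl⟩
        refine ⟨Pi.single ⟨k, hk⟩ ⟨m, hm⟩, ?_⟩
        rw [hΦ, Finset.sum_eq_single ⟨k, hk⟩]
        · rw [Pi.single_eq_same]; rfl
        · intro j _ hj
          rw [Pi.single_eq_of_ne hj]; rfl
        · simp
    have hΦinj : Function.Injective Φ := by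
      rw [← LinearMap.ker_eq_bot, LinearMap.ker_eq_bot']
      intro f hf
      rw [hΦ] at hf
      let v : Fin t → V := fun k => if hk : k ∈ S then (f ⟨k, hk⟩ : Fin t → V) k else 0
      have hvS : ∀ k : S, v k = (f k : Fin t → V) k := fun k => by simp [v]
      have hvn : ∀ k, k ∉ S → v k = 0 := fun k hk => by simp [v, hk]
      have hvK : v ∈ relK U := by
        refine ⟨fun j => ?_, ?_⟩
        · by_cases hj : j ∈ S
          · rw [hvS ⟨j, hj⟩]
            exact (hMK (f ⟨j, hj⟩).2).1 j
          · rw [hvn j hj]; exact Submodule.zero_mem _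
        · rw [← hf, ← Finset.sum_subset (Finset.subset_univ S) (fun k _ hk => hvn k hk),
            ← Finset.sum_coe_sort S]
          exact Finset.sum_congr rfl fun k _ => hvS k
      have hvN := mem_relN q hvK (hvn q hq)
      funext k
      apply Subtype.ext
      refine hinj k _ (f k).2 ?_
      rw [← hvS, ← map_relN]
      exact ⟨v, hvN, rfl⟩
    rw [← hran, LinearMap.finrank_range_of_inj hΦinj, Module.finrank_pi_fintype]
    simp [hfr, hMδ]
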